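/- Let A(Γ) act without inversions on a simplicial tree T with all edge stabilizers abelian, and suppose v ∈ V(Γ) acts hyperbolically on T. If v′ ∈ star(v) also acts hyperbolically on T, then star(v′) = star(v). -/

import Mathlib

/-- The relators of the right-angled Artin group of a graph `Γ`: one commutator
relator for each pair of adjacent vertices. -/
def raagRels {V : Type} (Γ : SimpleGraph V) : Set (FreeGroup V) :=
  {r | ∃ u v : V, Γ.Adj u v ∧
    r = FreeGroup.of u * FreeGroup.of v * (FreeGroup.of u)⁻¹ * (FreeGroup.of v)⁻¹}

/-- The right-angled Artin group `A(Γ)` of a graph `Γ`. -/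
abbrev RAAG {V : Type} (Γ : SimpleGraph V) : Type := PresentedGroup (raagRels Γ)

/-- The generator of `RAAG Γ` corresponding to a vertex `v`. -/
def RAAG.gen {V : Type} (Γ : SimpleGraph V) (v : V) : RAAG Γ := PresentedGroup.of v

section Action

variable {G W : Type} [Group G]

/-- The homomorphism `φ : G →* Equiv.Perm W` acts by automorphisms of the graph `T`. -/
def PreservesAdj (T : SimpleGraph W) (φ : G →* Equiv.Perm W) : Prop :=
  ∀ (g : G) (u v : W), T.Adj u v → T.Adj (φ g u) (φ g v)

/-- The action `φ` on the graph `T` is without edge inversions. -/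
def NoInversions (T : SimpleGraph W) (φ : G →* Equiv.Perm W) : Prop :=
  ∀ (g : G) (u v : W), T.Adj u v → ¬(φ g u = v ∧ φ g v = u)

/-- All edge stabilizers of the action `φ` on the graph `T` are abelian: any two
elements fixing both endpoints of an edge commute. -/
def AbelianEdgeStabilizers (T : SimpleGraph W) (φ : G →* Equiv.Perm W) : Prop :=
  ∀ u v : W, T.Adj u v → ∀ g h : G,
    φ g u = u → φ g v = v → φ h u = u → φ h v = v → g * h = h * g

/-- An element `g` is elliptic for the action `φ` if it fixes some vertex. -/
def Elliptic (φ : G →* Equiv.Perm W) (g : G) : Prop := ∃ w : W, φ g w = w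

/-- The action `φ` has a global fixed vertex. -/
def HasGlobalFixedVertex (φ : G →* Equiv.Perm W) : Prop := ∃ w : W, ∀ g : G, φ g w = w

end Action

/-- `K` is a separating clique of `Γ`: a clique whose removal disconnects `Γ`. -/
def SeparatingClique {V : Type} (Γ : SimpleGraph V) (K : Set V) : Prop :=
  Γ.IsClique K ∧ ∃ x y : ↥(Kᶜ), ¬ (Γ.induce Kᶜ).Reachable x y

/-- A group element acting on a graph, as a graph isomorphism. -/
def PreservesAdj.iso {G W : Type} [Group G] {T : SimpleGraph W} {φ : G →* Equiv.Perm W}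
    (hadj : PreservesAdj T φ) (g : G) : T ≃g T where
  toEquiv := φ g
  map_rel_iff' := by
    intro a b
    refine ⟨fun h => ?_, hadj g a b⟩
    simpa using hadj g⁻¹ _ _ h

theorem PreservesAdj.dist_map {G W : Type} [Group G] {T : SimpleGraph W} {φ : G →* Equiv.Perm W}
    (hadj : PreservesAdj T φ) (hT : T.Connected) (g : G) (x y : W) :
    T.dist (φ g x) (φ g y) = T.dist x y := by
  have key : ∀ (g : G) (x y : W), T.dist (φ g x) (φ g y) ≤ T.dist x y := by
    intro g x y
    obtain ⟨w, hw⟩ := hT.exists_walk_length_eq_dist x y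
    rw [← hw, ← SimpleGraph.Walk.length_map (hadj.iso g).toHom w]
    exact SimpleGraph.dist_le _
  refine le_antisymm (key g x y) ?_
  simpa using key g⁻¹ (φ g x) (φ g y)

namespace SimpleGraph

variable {W : Type} {T : SimpleGraph W}

/-- A bi-infinite walk without backtracking. -/
structure IsLine (T : SimpleGraph W) (p : ℤ → W) : Prop where
  adj : ∀ i, T.Adj (p i) (p (i + 1))
  ne : ∀ i, p i ≠ p (i + 2)

theorem dist_le_of_forall_adj (hT : T.Connected) {p : ℤ → W}
    (hp : ∀ i, T.Adj (p i) (p (i + 1))) (a : ℤ) (n : ℕ) : T.dist (p a) (p (a + n)) ≤ n := by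
  induction n with
  | zero => simp
  | succ n ih =>
    have h1 : T.dist (p (a + n)) (p (a + n + 1)) = 1 := dist_eq_one_iff_adj.mpr (hp _)
    have h2 := hT.dist_triangle (u := p a) (v := p (a + n)) (w := p (a + n + 1))
    push_cast
    rw [← add_assoc]
    lia

theorem IsLine.exists_isPath (hT : T.IsAcyclic) {p : ℤ → W} (hp : T.IsLine p) (a : ℤ) (n : ℕ) :
    ∀ b c, b = p (a + n) → c = p (a + n + 1) → ∃ q : T.Walk (p a) b, q.IsPath ∧ q.length = n ∧
      c ∉ q.support ∧ ∀ x ∈ q.support, ∃ j, x = p j := by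
  induction n with
  | zero =>
    rintro b c hb rfl
    obtain rfl : b = p a := by simpa using hb
    refine ⟨Walk.nil, by simp, rfl, ?_, ?_⟩
    · simpa using (hp.adj a).ne'
    · intro x hx
      exact ⟨a, by simpa using hx⟩
  | succ n ih =>
    rintro b c rfl rfl
    obtain ⟨q, hq, hl, hn, hs⟩ := ih (p (a + n)) (p (a + (n + 1 : ℕ))) rfl (by push_cast; ring_nf)
    have hadj : T.Adj (p (a + n)) (p (a + (n + 1 : ℕ))) := by
      have := hp.adj (a + n)
      push_cast
      rwa [← add_assoc]
    refine ⟨q.concat hadj, hq.concat hn hadj, by simp [hl], fun hc => ?_, ?_⟩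
    · have := hT.eq_penultimate_of_adj_end (hq.concat hn hadj) (hp.adj _) hc
      rw [Walk.penultimate_concat] at this
      apply hp.ne (a + n)
      rw [← this]
      push_cast
      ring_nf
    · intro x hx
      rw [Walk.support_concat] at hx
      simp only [List.mem_append, List.mem_singleton] at hx
      rcases hx with hx | rfl
      · exact hs x hx
      · exact ⟨_, rfl⟩

theorem IsTree.length_eq_dist (hT : T.IsTree) {x y : W} {q : T.Walk x y} (hq : q.IsPath) :
    q.length = T.dist x y := by
  obtain ⟨r, hr, hl⟩ := hT.connected.exists_path_of_dist x y
  rw [← hl, (hT.existsUnique_path x y).unique hq hr]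

theorem IsLine.dist_eq (hT : T.IsTree) {p : ℤ → W} (hp : T.IsLine p) (i j : ℤ) :
    (T.dist (p i) (p j) : ℤ) = |i - j| := by
  have key : ∀ (a : ℤ) (n : ℕ), T.dist (p a) (p (a + n)) = n := by
    intro a n
    obtain ⟨q, hq, hl, -⟩ := hp.exists_isPath hT.isAcyclic a n _ _ rfl rfl
    rw [← hT.length_eq_dist hq, hl]
  rcases le_total i j with h | h
  · obtain ⟨n, rfl⟩ := Int.le.dest h
    rw [key]; simp
  · obtain ⟨n, rfl⟩ := Int.le.dest h
    rw [dist_comm, key]; simp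

theorem Walk.dist_le_of_mem_support {x y z : W} (w : T.Walk x y) (hz : z ∈ w.support) :
    T.dist x z ≤ w.length ∧ T.dist z y ≤ w.length := by
  classical
  exact ⟨(dist_le _).trans (w.length_takeUntil_le_length hz),
    (dist_le _).trans (w.length_dropUntil_le_length hz)⟩

/-- A vertex of a line lies on any other line that comes close to the first one far away on
both sides of the vertex. -/
theorem IsLine.mem_of_dist_lt (hT : T.IsTree) {p r : ℤ → W} (hp : T.IsLine p) (hr : T.IsLine r)
    (i : ℤ) (N : ℕ) (h₁ : T.dist (r (i - N)) (p (i - N)) < N)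
    (h₂ : T.dist (p (i + N)) (r (i + N)) < N) : ∃ j, r i = p j := by
  classical
  obtain ⟨q, hq, hl, -, -⟩ := hr.exists_isPath hT.isAcyclic (i - N) (2 * N)
    (r (i + N)) _ (by push_cast; ring_nf) rfl
  obtain ⟨s, hs, -, -, hsp⟩ := hp.exists_isPath hT.isAcyclic (i - N) (2 * N)
    (p (i + N)) _ (by push_cast; ring_nf) rfl
  obtain ⟨u, hu⟩ := hT.connected.exists_walk_length_eq_dist (r (i - N)) (p (i - N))
  obtain ⟨v, hv⟩ := hT.connected.exists_walk_length_eq_dist (p (i + N)) (r (i + N))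
  have hmem : r i ∈ q.support := by
    obtain ⟨q₁, h₁, hl₁, -, -⟩ := hr.exists_isPath hT.isAcyclic (i - N) N
      (r i) _ (by ring_nf) rfl
    obtain ⟨q₂, h₂, hl₂, -, -⟩ := hr.exists_isPath hT.isAcyclic i N _ _ rfl rfl
    have hd := hT.length_eq_dist hq
    have : (q₁.append q₂).IsPath := by
      apply Walk.isPath_of_length_eq_dist
      rw [← hd, hl, Walk.length_append, hl₁, hl₂]
      lia
    rw [(hT.existsUnique_path _ _).unique hq this]
    simp
  have hsub : r i ∈ (u.append (s.append v)).support := by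
    apply Walk.support_bypass_subset_support
    rwa [(hT.existsUnique_path _ _).unique (Walk.bypass_isPath _) hq]
  have d₁ := hr.dist_eq hT (i - N) i
  have d₂ := hr.dist_eq hT i (i + N)
  simp only [sub_sub_cancel_left, abs_neg, Nat.abs_cast, sub_add_cancel_left] at d₁ d₂
  simp only [Walk.mem_support_append_iff] at hsub
  rcases hsub with h | h | h
  · have := (u.dist_le_of_mem_support h).1
    lia
  · exact hsp _ h
  · have := (v.dist_le_of_mem_support h).2
    lia

end SimpleGraph

section Action

variable {G W : Type} [Group G] {T : SimpleGraph W} {φ : G →* Equiv.Perm W}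

theorem exists_isLine_of_not_elliptic (hT : T.Connected) (hadj : PreservesAdj T φ)
    (hni : NoInversions T φ) {g : G} (hg : ¬ Elliptic φ g) :
    ∃ (l : ℕ) (p : ℤ → W), 0 < l ∧ T.IsLine p ∧ ∀ i k : ℤ, p (i + k * l) = φ (g ^ k) (p i) := by
  have := hT.nonempty
  obtain ⟨x, hx⟩ : ∃ x, ∀ y, T.dist x (φ g x) ≤ T.dist y (φ g y) := by
    exact ⟨Function.argmin fun y => T.dist y (φ g y),
      fun y => Function.argmin_le (fun y => T.dist y (φ g y)) y⟩
  obtain ⟨w, hw⟩ := hT.exists_walk_length_eq_dist x (φ g x)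
  have hl : 0 < w.length := by
    rw [hw]
    exact hT.pos_dist_of_ne fun h => hg ⟨x, h.symm⟩
  set l := w.length with hldef
  have hl' : (0 : ℤ) < l := by exact_mod_cast hl
  let p : ℤ → W := fun i => φ (g ^ (i / (l : ℤ))) (w.getVert (i % (l : ℤ)).toNat)
  have hper : ∀ i k : ℤ, p (i + k * l) = φ (g ^ k) (p i) := by
    intro i k
    simp only [p]
    rw [Int.add_mul_ediv_right _ _ hl'.ne', Int.add_mul_emod_self_right, add_comm, zpow_add,
      map_mul, Equiv.Perm.mul_apply]
  have hper1 : ∀ i : ℤ, p (i + l) = φ g (p i) := by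
    intro i
    simpa using hper i 1
  have hp0 : ∀ i : ℕ, i ≤ l → p i = w.getVert i := by
    intro i hi
    rcases hi.lt_or_eq with hi | rfl
    · have h1 : (i : ℤ) / l = 0 := Int.ediv_eq_zero_of_lt (by lia) (by lia)
      have h2 : (i : ℤ) % l = i := Int.emod_eq_of_lt (by lia) (by lia)
      simp [p, h1, h2]
    · have := hper1 0
      simp only [zero_add] at this
      rw [this]
      simp [p, hldef]
  have hpadj : ∀ i, T.Adj (p i) (p (i + 1)) := by
    intro i
    have hi : i = ((i % l).toNat : ℤ) + (i / l) * l := by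
      rw [Int.toNat_of_nonneg (Int.emod_nonneg _ hl'.ne')]
      exact (Int.emod_add_ediv_mul i l).symm
    have hlt : (i % l).toNat < l := by
      have := Int.emod_lt_of_pos i hl'
      lia
    generalize (i % l).toNat = m at hi hlt
    generalize i / (l : ℤ) = k at hi
    subst hi
    rw [add_right_comm, hper, hper]
    apply hadj
    have := hp0 (m + 1) hlt
    push_cast at this
    rw [this, hp0 m hlt.le]
    exact w.adj_getVert_succ hlt
  refine ⟨l, p, hl, ⟨hpadj, fun i hi => ?_⟩, hper⟩
  rcases Nat.lt_or_ge l 2 with h2 | h2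
  · have h1 : l = 1 := by lia
    rw [h1] at hper1
    apply hni g _ _ (hpadj i)
    have e1 := hper1 i
    have e2 := hper1 (i + 1)
    push_cast at e1 e2
    refine ⟨e1.symm, ?_⟩
    rw [← e2, hi]
    ring_nf
  · obtain ⟨m, hm⟩ := Nat.exists_eq_add_of_le h2
    have h3 := SimpleGraph.dist_le_of_forall_adj hT hpadj (i + 2) m
    have h4 : p (i + 2 + m) = φ g (p (i + 2)) := by
      rw [← hi, ← hper1, hm]
      push_cast
      ring_nf
    rw [h4] at h3
    have := hx (p (i + 2))
    lia

/-- An element commuting with a hyperbolic element translates the axis of the latter. -/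
theorem exists_translation_of_commute (hT : T.IsTree) (hadj : PreservesAdj T φ) {g h : G}
    (hgh : Commute g h) {l : ℕ} {p : ℤ → W} (hl : 0 < l) (hp : T.IsLine p)
    (hper : ∀ i k : ℤ, p (i + k * l) = φ (g ^ k) (p i)) :
    ∃ c : ℤ, ∀ i, φ h (p i) = p (i + c) := by
  have hr : T.IsLine fun i => φ h (p i) :=
    ⟨fun i => hadj h _ _ (hp.adj i), fun i e => hp.ne i ((φ h).injective e)⟩
  have hrper : ∀ i k : ℤ, φ h (p (i + k * l)) = φ (g ^ k) (φ h (p i)) := by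
    intro i k
    rw [hper, ← Equiv.Perm.mul_apply, ← Equiv.Perm.mul_apply, ← map_mul, ← map_mul,
      (hgh.zpow_left k).eq]
  have hD : ∀ i k : ℤ, T.dist (φ h (p (i + k * l))) (p (i + k * l)) =
      T.dist (φ h (p i)) (p i) := by
    intro i k
    rw [hrper, hper, hadj.dist_map hT.connected]
  have hex : ∀ i, ∃ j, φ h (p i) = p j := by
    intro i
    set k := T.dist (φ h (p i)) (p i) + 1 with hk
    have hkl : k ≤ k * l := Nat.le_mul_of_pos_right _ hl
    refine hp.mem_of_dist_lt hT hr i (k * l) ?_ ?_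
    · have := hD i (-k)
      have e : i - (k * l : ℕ) = i + (-k) * l := by push_cast; ring
      rw [e, this]
      lia
    · have := hD i k
      have e : i + (k * l : ℕ) = i + k * l := by push_cast; ring
      rw [e, SimpleGraph.dist_comm, this]
      lia
  choose f hf using hex
  have hinj : ∀ i j, p i = p j → i = j := by
    intro i j e
    have := hp.dist_eq hT i j
    rw [e, SimpleGraph.dist_self] at this
    exact sub_eq_zero.mp (abs_eq_zero.mp this.symm)
  have hfd : ∀ i j, |f i - f j| = |i - j| := by
    intro i j
    rw [← hp.dist_eq hT, ← hp.dist_eq hT, ← hf, ← hf, hadj.dist_map hT.connected]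
  have hfper : ∀ k : ℤ, f (k * l) = f 0 + k * l := by
    intro k
    apply hinj
    rw [← hf, hper, ← hf]
    simpa using hrper 0 k
  refine ⟨f 0, fun i => ?_⟩
  rw [hf]
  congr 1
  have h1 := hfd i 0
  have h2 := hfd i ((|i| + 1) * l)
  rw [hfper] at h2
  have h3 : |i| + 1 ≤ (|i| + 1) * l :=
    le_mul_of_one_le_right (by positivity) (by exact_mod_cast hl)
  generalize (|i| + 1) * (l : ℤ) = N at h2 h3
  grind

theorem zpow_mul_pow_apply_of_translation {g h : G} {l : ℕ} {p : ℤ → W} {c : ℤ}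
    (hper : ∀ i k : ℤ, p (i + k * l) = φ (g ^ k) (p i)) (hc : ∀ i, φ h (p i) = p (i + c)) (i : ℤ) :
    φ (g ^ (-c) * h ^ l) (p i) = p i := by
  have hpow : ∀ n : ℕ, ∀ i, φ (h ^ n) (p i) = p (i + n * c) := by
    intro n
    induction n with
    | zero => simp
    | succ n ih =>
      intro i
      rw [pow_succ, map_mul, Equiv.Perm.mul_apply, hc, ih]
      push_cast
      ring_nf
  rw [map_mul, Equiv.Perm.mul_apply, hpow, ← hper]
  ring_nf

end Action

section RAAG

variable {V : Type} (Γ : SimpleGraph V)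

theorem RAAG.commute_gen {u v : V} (h : Γ.Adj u v) :
    Commute (RAAG.gen Γ u) (RAAG.gen Γ v) := by
  have : PresentedGroup.mk (raagRels Γ) (FreeGroup.of u * FreeGroup.of v * (FreeGroup.of u)⁻¹ *
      (FreeGroup.of v)⁻¹) = 1 := PresentedGroup.one_of_mem ⟨u, v, h, rfl⟩
  simp only [map_mul, map_inv] at this
  rw [mul_inv_eq_one, mul_inv_eq_iff_eq_mul] at this
  exact this

/-- Homomorphisms out of `RAAG Γ` are given by maps sending adjacent vertices to commuting
elements. -/
theorem RAAG.exists_hom {H : Type} [Group H] (f : V → H)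
    (hf : ∀ u v, Γ.Adj u v → Commute (f u) (f v)) :
    ∃ F : RAAG Γ →* H, ∀ v, F (RAAG.gen Γ v) = f v := by
  refine ⟨PresentedGroup.toGroup (f := f) ?_, fun v => PresentedGroup.toGroup.of _⟩
  rintro _ ⟨u, v, h, rfl⟩
  simp [(hf u v h).eq]

/-- Powers of generators at distinct non-adjacent vertices do not commute, even modulo any
third generator. -/
theorem RAAG.not_commute_of_not_adj {u v w : V} (hvu : u ≠ v) (hwu : w ≠ u) (hwv : w ≠ v)
    (hadj : ¬ Γ.Adj u v) {n : ℕ} (hn : 0 < n) (c d : ℤ) :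
    ¬ Commute (RAAG.gen Γ w ^ c * RAAG.gen Γ u ^ n) (RAAG.gen Γ w ^ d * RAAG.gen Γ v ^ n) := by
  classical
  intro hcomm
  let X : Equiv.Perm ℚ := Equiv.addRight 1
  let Y : Equiv.Perm ℚ := Equiv.mulRight₀ 2 two_ne_zero
  obtain ⟨F, hF⟩ := RAAG.exists_hom Γ (fun z => if z = u then X else if z = v then Y else 1) (by
    intro a b hab
    have := hab.symm
    by_cases a = u <;> by_cases a = v <;> by_cases b = u <;> by_cases b = v <;> simp_all)
  have h := hcomm.map F
  simp only [map_mul, map_zpow, map_pow, hF, hwu, hwv, hvu.symm, if_true, if_false, one_zpow,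
    one_mul] at h
  have hX : ∀ (m : ℕ) (t : ℚ), (X ^ m) t = t + m := by
    intro m
    induction m with
    | zero => simp
    | succ m ih => intro t; rw [pow_succ, Equiv.Perm.mul_apply, ih]; simp [X]; ring
  have hY : ∀ (m : ℕ) (t : ℚ), (Y ^ m) t = t * 2 ^ m := by
    intro m
    induction m with
    | zero => simp
    | succ m ih => intro t; rw [pow_succ, Equiv.Perm.mul_apply, ih]; simp [Y]; ring
  have h0 := congrArg (fun σ : Equiv.Perm ℚ => σ 0) h.eq
  simp only [Equiv.Perm.mul_apply, hX, hY, zero_mul, zero_add] at h0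
  have h1 : (1 : ℚ) < 2 ^ n := one_lt_pow₀ one_lt_two hn.ne'
  have h2 : (0 : ℚ) < n := by exact_mod_cast hn
  nlinarith

theorem star_subset_star_of_hyperbolic {W : Type} {T : SimpleGraph W} (hT : T.IsTree)
    {φ : RAAG Γ →* Equiv.Perm W} (hadj : PreservesAdj T φ) (hni : NoInversions T φ)
    (hab : AbelianEdgeStabilizers T φ) {v v' : V} (hv : ¬ Elliptic φ (RAAG.gen Γ v))
    (hvv' : Γ.Adj v v') :
    insert v (Γ.neighborSet v) ⊆ insert v' (Γ.neighborSet v') := by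
  rintro w (rfl | hw)
  · exact Or.inr hvv'.symm
  by_contra hcon
  simp only [Set.mem_insert_iff, SimpleGraph.mem_neighborSet, not_or] at hcon hw
  obtain ⟨l, p, hl, hp, hper⟩ := exists_isLine_of_not_elliptic hT.connected hadj hni hv
  obtain ⟨c, hc⟩ := exists_translation_of_commute hT hadj (RAAG.commute_gen Γ hw) hl hp hper
  obtain ⟨d, hd⟩ := exists_translation_of_commute hT hadj (RAAG.commute_gen Γ hvv') hl hp hper
  have hwfix := zpow_mul_pow_apply_of_translation hper hc
  have hvfix := zpow_mul_pow_apply_of_translation hper hd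
  exact RAAG.not_commute_of_not_adj Γ hcon.1 hw.ne hvv'.ne (fun h => hcon.2 h.symm) hl (-c) (-d)
    (hab _ _ (hp.adj 0) _ _ (hwfix 0) (hwfix _) (hvfix 0) (hvfix _))

end RAAG

/-- If `A(Γ)` acts without inversions on a simplicial tree with abelian edge
stabilizers, `v ∈ V(Γ)` acts hyperbolically, and `v′ ∈ star(v)` also acts
hyperbolically, then `star(v′) = star(v)`. -/
theorem star_eq_star_of_hyperbolic {V W : Type} [Finite V]
    (Γ : SimpleGraph V) (T : SimpleGraph W) (hT : T.IsTree)
    (φ : RAAG Γ →* Equiv.Perm W)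
    (hadj : PreservesAdj T φ) (hni : NoInversions T φ)
    (hab : AbelianEdgeStabilizers T φ)
    (v v' : V) (hv : ¬ Elliptic φ (RAAG.gen Γ v))
    (hv' : v' ∈ insert v (Γ.neighborSet v))
    (hv'hyp : ¬ Elliptic φ (RAAG.gen Γ v')) :
    insert v' (Γ.neighborSet v') = insert v (Γ.neighborSet v) := by
  rcases hv' with rfl | hvv'
  · rfl
  · exact (star_subset_star_of_hyperbolic Γ hT hadj hni hab hv'hyp hvv'.symm).antisymm
      (star_subset_star_of_hyperbolic Γ hT hadj hni hab hv hvv')
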